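/- Fix r > 0 and ε > 0 with 2ε < r/3. Let {O_i}_{i ∈ I} be a finite set of points in the Euclidean plane ℝ², let B_R = closedBall(O, r/3) for some point O, and assume the circles {sphere(O_i, r)}_{i ∈ I} together with sphere(O, r/3) are in general position (any two of these circles are either disjoint or intersect transversally in exactly two points, and no point lies on three of them). Let ℛ₂ = B_R \ (⋃_{i ∈ I} closedBall(O_i, r)). Then the area (two-dimensional Lebesgue measure) of the union, over all connected components S of ℛ₂ with ℋ¹(frontier S) > 6πε (the 'large' components), of the ε-tubes t_ε(frontier S) = {Q : dist(Q, frontier S) ≤ ε}, is at most 4πεr/3. -/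

import Mathlib

open MeasureTheory
open scoped ENNReal

section Reach

variable {E : Type*} [NormedAddCommGroup E] [InnerProductSpace ℝ E]

/-- The number `b` for which `b • e` lies at distance `k - ‖Q‖` from `Q`
(the largest of the two candidates). -/
noncomputable def reach (k : ℝ) (e Q : E) : ℝ :=
  inner ℝ e Q + √(k ^ 2 - 2 * k * ‖Q‖ + inner ℝ e Q ^ 2)

/-- Translation of `Q` in the direction `-e`, onto the circle of radius `k - ‖Q‖`
around `a • e`. -/
noncomputable def pull (k a : ℝ) (e Q : E) : E := Q - (reach k e Q - a) • e

lemma reach_radicand_pos {k : ℝ} {Q : E} (e : E) (hk : 0 < k) (hQ : 2 * ‖Q‖ < k) :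
    0 < k ^ 2 - 2 * k * ‖Q‖ + inner ℝ e Q ^ 2 := by
  nlinarith [mul_pos hk (sub_pos.2 hQ), sq_nonneg (inner ℝ e Q)]

lemma reach_pos {k : ℝ} {Q : E} (e : E) (hk : 0 < k) (hQ : 2 * ‖Q‖ < k) :
    0 < reach k e Q := by
  have h : |inner ℝ e Q| < √(k ^ 2 - 2 * k * ‖Q‖ + inner ℝ e Q ^ 2) := by
    apply Real.lt_sqrt_of_sq_lt
    rw [sq_abs]
    nlinarith [mul_pos hk (sub_pos.2 hQ)]
  have := neg_abs_le (inner ℝ e Q)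
  unfold reach
  linarith

lemma norm_sub_reach_smul {k : ℝ} {e Q : E} (he : ‖e‖ = 1) (hk : 0 < k) (hQ : 2 * ‖Q‖ < k) :
    ‖Q - reach k e Q • e‖ = k - ‖Q‖ := by
  have hs := Real.sq_sqrt (reach_radicand_pos e hk hQ).le
  have hQ0 := norm_nonneg Q
  rw [← sq_eq_sq₀ (norm_nonneg _) (by linarith), norm_sub_sq_real, inner_smul_right, norm_smul,
    he, mul_one, Real.norm_eq_abs, sq_abs, real_inner_comm]
  unfold reach
  linear_combination hs

lemma norm_sub_smul_le_of_le_reach {k a : ℝ} {e Q : E} (he : ‖e‖ = 1) (hk : 0 < k)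
    (hQ : 2 * ‖Q‖ < k) (hea : inner ℝ e Q ≤ a) (har : a ≤ reach k e Q) :
    ‖Q - a • e‖ ≤ k - ‖Q‖ := by
  have hQe : (inner ℝ Q e : ℝ) = inner ℝ e Q := real_inner_comm _ _
  rw [← sq_le_sq₀ (norm_nonneg _) (by linarith [norm_nonneg Q]),
    ← norm_sub_reach_smul he hk hQ, norm_sub_sq_real, norm_sub_sq_real, inner_smul_right,
    inner_smul_right, norm_smul, norm_smul, he, mul_one, mul_one, Real.norm_eq_abs,
    Real.norm_eq_abs, sq_abs, sq_abs, hQe]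
  nlinarith

lemma continuous_reach (k : ℝ) (e : E) : Continuous (reach k e) := by
  unfold reach
  fun_prop

lemma exists_hasFDerivAt_pull [FiniteDimensional ℝ E] {k : ℝ} (a : ℝ) {e Q : E} (he : ‖e‖ = 1)
    (hk : 0 < k) (hQ0 : Q ≠ 0) (hQ : 2 * ‖Q‖ < k) :
    ∃ f' : E →L[ℝ] E, HasFDerivAt (pull k a e) f' Q ∧ |f'.det| ≤ 1 := by
  set z : ℝ := inner ℝ e Q with hz
  have hs := reach_radicand_pos e hk hQ
  set s : ℝ := k ^ 2 - 2 * k * ‖Q‖ + z ^ 2 with hsdef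
  have hq : 0 < ‖Q‖ := norm_pos_iff.2 hQ0
  have hinner : HasFDerivAt (fun x : E => (inner ℝ e x : ℝ)) (innerSL ℝ e) Q :=
    (innerSL ℝ e).hasFDerivAt
  have hnorm : HasFDerivAt (fun x : E => ‖x‖) (‖Q‖⁻¹ • innerSL ℝ Q) Q := by
    have h := ((hasStrictFDerivAt_norm_sq Q).hasFDerivAt).sqrt (by positivity)
    simp only [Real.sqrt_sq (norm_nonneg _)] at h
    refine h.congr_fderiv ?_
    ext x
    simp
    field_simp
  have hrad : HasFDerivAt (fun x : E => k ^ 2 - 2 * k * ‖x‖ + (inner ℝ e x : ℝ) ^ 2)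
      (-((2 * k) • (‖Q‖⁻¹ • innerSL ℝ Q)) + (2 * z) • innerSL ℝ e) Q := by
    refine (((hnorm.const_mul (2 * k)).const_sub (k ^ 2)).add (hinner.pow 2)).congr_fderiv ?_
    ext x
    simp [hz]
  have hreach := hinner.add (hrad.sqrt hs.ne')
  set g : E →L[ℝ] ℝ := innerSL ℝ e + (1 / (2 * √s)) •
    (-((2 * k) • (‖Q‖⁻¹ • innerSL ℝ Q)) + (2 * z) • innerSL ℝ e) with hg
  have hpull : HasFDerivAt (pull k a e) (ContinuousLinearMap.id ℝ E - g.smulRight e) Q :=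
    (hasFDerivAt_id Q).sub ((hreach.sub_const a).smul_const e)
  refine ⟨_, hpull, ?_⟩
  have hdet : (ContinuousLinearMap.id ℝ E - g.smulRight e).det = 1 - g e := by
    have : ((ContinuousLinearMap.id ℝ E - g.smulRight e : E →L[ℝ] E) : E →ₗ[ℝ] E) =
        LinearMap.transvection (-(g : E →ₗ[ℝ] ℝ)) e := by
      ext x
      simp [LinearMap.transvection, sub_eq_add_neg]
    rw [ContinuousLinearMap.det, this, LinearMap.transvection.det]
    simp [sub_eq_add_neg]
  have hsq : 0 < √s := Real.sqrt_pos.2 hs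
  have hge : 1 - g e = z * (k - ‖Q‖) / (‖Q‖ * √s) := by
    have h1 : (inner ℝ Q e : ℝ) = z := real_inner_comm _ _
    have h2 : (inner ℝ e e : ℝ) = 1 := by rw [real_inner_self_eq_norm_sq, he, one_pow]
    simp only [hg, add_apply, smul_apply, neg_apply,
      innerSL_apply_apply, h1, h2, smul_eq_mul]
    field_simp
    ring
  have hzq : z ^ 2 ≤ ‖Q‖ ^ 2 := by
    have := abs_real_inner_le_norm e Q
    rw [he, one_mul] at this
    exact sq_le_sq' (by linarith [neg_abs_le z]) (by linarith [le_abs_self z])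
  rw [hdet, hge, abs_div, div_le_one (by positivity), ← sq_le_sq₀ (abs_nonneg _) (abs_nonneg _),
    sq_abs, sq_abs, mul_pow, mul_pow, Real.sq_sqrt hs.le]
  nlinarith [mul_nonneg (sub_nonneg.2 hzq) (mul_pos hk (sub_pos.2 hQ)).le]

lemma volume_image_pull_le [FiniteDimensional ℝ E] [MeasurableSpace E] [BorelSpace E]
    {k : ℝ} (a : ℝ) {e : E} {s : Set E} (he : ‖e‖ = 1) (hk : 0 < k) (hs : MeasurableSet s)
    (hs0 : ∀ Q ∈ s, Q ≠ 0 ∧ 2 * ‖Q‖ < k) :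
    volume (pull k a e '' s) ≤ volume s := by
  choose! f' hf' hdet using fun Q (hQ : Q ∈ s) =>
    exists_hasFDerivAt_pull a he hk (hs0 Q hQ).1 (hs0 Q hQ).2
  calc volume (pull k a e '' s) ≤ ∫⁻ x in s, ENNReal.ofReal |(f' x).det| :=
        addHaar_image_le_lintegral_abs_det_fderiv volume hs
          fun x hx => (hf' x hx).hasFDerivWithinAt
    _ ≤ ∫⁻ _ in s, 1 := setLIntegral_mono' hs fun x hx => by
        simpa using hdet x hx
    _ = volume s := by simp

/-- If `P` lies on the circle of radius `k - q` around `a • e`, then moving `P` in the direction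
`e` up to norm `q` is inverted by `pull`. -/
lemma exists_pull_eq {k a q : ℝ} {e P : E} (he : ‖e‖ = 1) (hPa : ‖P‖ ≤ a) (hPq : ‖P‖ ≤ q)
    (hP : ‖P - a • e‖ = k - q) :
    ∃ Q : E, ‖Q‖ = q ∧ a ≤ reach k e Q ∧ pull k a e Q = P := by
  set y : ℝ := inner ℝ e P with hy
  have hyP : |y| ≤ ‖P‖ := by simpa [he] using abs_real_inner_le_norm e P
  have hP0 := norm_nonneg P
  have hrad : 0 ≤ y ^ 2 + (q ^ 2 - ‖P‖ ^ 2) := by nlinarith [sq_nonneg y]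
  set w : ℝ := √(y ^ 2 + (q ^ 2 - ‖P‖ ^ 2)) with hw
  have hw2 : w ^ 2 = y ^ 2 + (q ^ 2 - ‖P‖ ^ 2) := Real.sq_sqrt hrad
  have hyw : y ≤ w := Real.le_sqrt_of_sq_le (by nlinarith)
  have hee : (inner ℝ e e : ℝ) = 1 := by rw [real_inner_self_eq_norm_sq, he, one_pow]
  have hPe : (inner ℝ P e : ℝ) = y := real_inner_comm _ _
  have hnorm : ‖P + (w - y) • e‖ = q := by
    rw [← sq_eq_sq₀ (norm_nonneg _) (hP0.trans hPq), norm_add_sq_real, inner_smul_right, hPe,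
      norm_smul, he, mul_one, Real.norm_eq_abs, sq_abs]
    linear_combination hw2
  have hin : (inner ℝ e (P + (w - y) • e) : ℝ) = w := by
    rw [inner_add_right, inner_smul_right, hee]
    ring
  have hdist : ‖P‖ ^ 2 - 2 * (a * y) + a ^ 2 = (k - q) ^ 2 := by
    rw [← hP, norm_sub_sq_real, inner_smul_right, hPe, norm_smul, he, mul_one, Real.norm_eq_abs,
      sq_abs]
  have hreach : reach k e (P + (w - y) • e) = w + (a - y) := by
    unfold reach
    rw [hnorm, hin, ← Real.sqrt_sq (show 0 ≤ a - y by linarith [le_abs_self y])]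
    congr 2
    linear_combination hw2 - hdist
  refine ⟨P + (w - y) • e, hnorm, by rw [hreach]; linarith, ?_⟩
  rw [pull, hreach, show w + (a - y) - a = w - y by ring, add_sub_cancel_right]

/-- Among the points `pull k (a i) (e i) Q`, one with minimal ratio `a i / reach k (e i) Q` is the
only one that can stay outside of the open balls of radius `k - ‖Q‖` around the `a j • e j`. -/
lemma pull_eq_pull_of_ratio_le {k a a' : ℝ} {e e' Q : E} (he : ‖e‖ = 1) (he' : ‖e'‖ = 1)
    (hk : 0 < k) (hQ : 2 * ‖Q‖ < k) (ha' : 0 < a') (har : a ≤ reach k e Q)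
    (hle : a' / reach k e' Q ≤ a / reach k e Q)
    (hout : k - ‖Q‖ ≤ ‖pull k a e Q - a' • e'‖) :
    pull k a' e' Q = pull k a e Q := by
  have hb := reach_pos e hk hQ
  have hb' := reach_pos e' hk hQ
  have hA := norm_sub_reach_smul he hk hQ
  have hB := norm_sub_reach_smul he' hk hQ
  set b := reach k e Q
  set b' := reach k e' Q
  obtain ⟨μ, rfl⟩ : ∃ μ, a = μ * b := ⟨a / b, by field_simp⟩
  obtain ⟨μ', rfl⟩ : ∃ μ', a' = μ' * b' := ⟨a' / b', by field_simp⟩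
  rw [mul_div_cancel_right₀ _ hb.ne', mul_div_cancel_right₀ _ hb'.ne'] at hle
  have hμ' : 0 < μ' := pos_of_mul_pos_left ha' hb'.le
  have hμ : μ ≤ 1 := by
    by_contra! h
    nlinarith
  have hp : pull k (μ * b) e Q = Q - (1 - μ) • (b • e) := by
    rw [pull, smul_smul]; congr 2; ring
  have hp' : pull k (μ' * b') e' Q = Q - (1 - μ') • (b' • e') := by
    rw [pull, smul_smul]; congr 2; ring
  rw [hp, hp']
  rw [hp] at hout
  set A := Q - b • e with hAdef
  set B := Q - b' • e' with hBdef
  have hbe : b • e = Q - A := by simp [hAdef]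
  have hbe' : b' • e' = Q - B := by simp [hBdef]
  rw [hbe, hbe']
  have hsplit : Q - (1 - μ) • (b • e) - (μ' * b') • e' =
      (μ - μ') • Q + ((1 - μ) • A + μ' • B) := by
    rw [mul_smul, hbe, hbe']
    module
  rw [hsplit] at hout
  have hμeq : μ = μ' := by
    by_contra hne
    have hlt : 0 < μ - μ' := sub_pos.2 (lt_of_le_of_ne hle (Ne.symm hne))
    have h1 : ‖(μ - μ') • Q + ((1 - μ) • A + μ' • B)‖ ≤
        (μ - μ') * ‖Q‖ + ((1 - μ) * (k - ‖Q‖) + μ' * (k - ‖Q‖)) := by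
      refine (norm_add_le _ _).trans (add_le_add ?_ ((norm_add_le _ _).trans (add_le_add ?_ ?_)))
      · rw [norm_smul, Real.norm_of_nonneg hlt.le]
      · rw [norm_smul, Real.norm_of_nonneg (by linarith), hA]
      · rw [norm_smul, Real.norm_of_nonneg hμ'.le, hB]
    nlinarith
  subst hμeq
  have hsq : ‖(1 - μ) • A + μ • B‖ ^ 2 = (k - ‖Q‖) ^ 2 - (1 - μ) * μ * ‖A - B‖ ^ 2 := by
    rw [norm_add_sq_real, norm_sub_sq_real, norm_smul, norm_smul, mul_pow, mul_pow,
      Real.norm_eq_abs, Real.norm_eq_abs, sq_abs, sq_abs, inner_smul_left, inner_smul_right, hA,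
      hB]
    simp
    ring
  rw [sub_self, zero_smul, zero_add] at hout
  have hge : (k - ‖Q‖) ^ 2 ≤ ‖(1 - μ) • A + μ • B‖ ^ 2 :=
    pow_le_pow_left₀ (by linarith [norm_nonneg Q]) hout 2
  rcases hμ.eq_or_lt with h1 | h1
  · simp [h1]
  · have hAB : ‖A - B‖ ^ 2 ≤ 0 := by
      by_contra! h
      nlinarith [mul_pos (mul_pos (sub_pos.2 h1) hμ') h]
    have : A = B := by
      rw [← sub_eq_zero, ← norm_eq_zero]
      exact pow_eq_zero_iff two_ne_zero |>.1 (le_antisymm hAB (sq_nonneg _))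
    rw [this]

end Reach

/-- The closed annulus `R - ε ≤ ‖Q‖ ≤ R + ε` has at least the volume of the set of points of
`closedBall 0 (R + ε)` that lie `ε`-close to the boundary of the ball of radius `R` around `0` or
of a ball of radius `r` around some `c i`, but not deeper than `ε` inside any of the latter. -/
lemma volume_near_spheres_le {E : Type*} [NormedAddCommGroup E] [InnerProductSpace ℝ E]
    [FiniteDimensional ℝ E] [MeasurableSpace E] [BorelSpace E] {ι : Type*} [Fintype ι]
    {R r ε : ℝ} (c : ι → E) (hε : 0 ≤ ε) (hεR : ε < R) (hRr : R + ε < r - ε)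
    (hc : ∀ i, R + ε ≤ ‖c i‖) :
    volume {P : E | ‖P‖ ≤ R + ε ∧ (∀ i, r - ε ≤ ‖P - c i‖) ∧
        (R - ε ≤ ‖P‖ ∨ ∃ i, ‖P - c i‖ ≤ r + ε)} ≤
      volume {Q : E | R - ε ≤ ‖Q‖ ∧ ‖Q‖ ≤ R + ε} := by
  classical
  let _ : LinearOrder ι := LinearOrder.lift' (Fintype.equivFin ι) (Fintype.equivFin ι).injective
  set k : ℝ := R + r with hkdef
  have hk : 0 < k := by linarith
  have hc0 : ∀ i, 0 < ‖c i‖ := fun i => by linarith [hc i]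
  set e : ι → E := fun i => ‖c i‖⁻¹ • c i with hedef
  have he : ∀ i, ‖e i‖ = 1 := fun i => by
    rw [hedef, norm_smul, norm_inv, norm_norm, inv_mul_cancel₀ (hc0 i).ne']
  have hce : ∀ i, ‖c i‖ • e i = c i := fun i => smul_inv_smul₀ (hc0 i).ne' _
  set A : Set E := {Q : E | R - ε ≤ ‖Q‖ ∧ ‖Q‖ ≤ R + ε} with hA
  have hAm : MeasurableSet A :=
    (measurableSet_le measurable_const measurable_norm).inter
      (measurableSet_le measurable_norm measurable_const)
  have hA0 : ∀ Q ∈ A, Q ≠ 0 ∧ 2 * ‖Q‖ < k := fun Q hQ =>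
    ⟨norm_pos_iff.1 (by linarith [hQ.1]), by linarith [hQ.2]⟩
  set u : ι → E → ℝ := fun i Q => ‖c i‖ / reach k (e i) Q with hu
  have hum : ∀ i, Measurable (u i) := fun i =>
    measurable_const.div (continuous_reach k (e i)).measurable
  set Y : ι → Set E := fun i => {Q | Q ∈ A ∧ u i Q ≤ 1 ∧
    ∀ j, u i Q < u j Q ∨ u i Q = u j Q ∧ i ≤ j} with hY
  have hYA : ∀ i, Y i ⊆ A := fun i Q hQ => hQ.1
  have hYm : ∀ i, MeasurableSet (Y i) := fun i => by
    refine hAm.inter ((measurableSet_le (hum i) measurable_const).inter ?_)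
    have : {Q : E | ∀ j, u i Q < u j Q ∨ u i Q = u j Q ∧ i ≤ j} =
        ⋂ j, ({Q | u i Q < u j Q} ∪ ({Q | u i Q = u j Q} ∩ {_Q | i ≤ j})) := by
      ext Q
      simp
    change MeasurableSet {Q : E | ∀ j, u i Q < u j Q ∨ u i Q = u j Q ∧ i ≤ j}
    rw [this]
    exact MeasurableSet.iInter fun j => (measurableSet_lt (hum i) (hum j)).union
      ((measurableSet_eq_fun (hum i) (hum j)).inter (MeasurableSet.const _))
  have hYd : Pairwise (Function.onFun Disjoint Y) := by
    intro i j hij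
    refine Set.disjoint_left.2 fun Q hi hj => hij ?_
    rcases hi.2.2 j with h1 | ⟨h1, h1'⟩ <;> rcases hj.2.2 i with h2 | ⟨h2, h2'⟩
    · exact absurd h1 h2.not_gt
    · exact absurd h1 h2.not_gt
    · exact absurd h2 h1.not_gt
    · exact le_antisymm h1' h2'
  have hcover : {P : E | ‖P‖ ≤ R + ε ∧ (∀ i, r - ε ≤ ‖P - c i‖) ∧
      (R - ε ≤ ‖P‖ ∨ ∃ i, ‖P - c i‖ ≤ r + ε)} ⊆
      (A \ ⋃ i, Y i) ∪ ⋃ i, pull k ‖c i‖ (e i) '' Y i := by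
    rintro P ⟨hP1, hP2, hP3⟩
    by_cases hnear : ∃ i, ‖P‖ + ‖P - c i‖ ≤ k
    · right
      obtain ⟨i₀, hi₀⟩ := hnear
      obtain ⟨i, -, hi⟩ := Finset.exists_min_image Finset.univ (fun i => ‖P - c i‖)
        ⟨i₀, Finset.mem_univ _⟩
      replace hi : ∀ j, ‖P - c i‖ ≤ ‖P - c j‖ := fun j => hi j (Finset.mem_univ _)
      have hik : ‖P‖ ≤ k - ‖P - c i‖ := by linarith [hi i₀]
      obtain ⟨Q, hQn, hQr, hQP⟩ := exists_pull_eq (k := k) (he i) (hP1.trans (hc i)) hik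
        (by rw [hce]; ring)
      have hir : ‖P - c i‖ ≤ r + ε := by
        rcases hP3 with h | ⟨j, hj⟩
        · linarith
        · exact (hi j).trans hj
      have hQA : Q ∈ A := ⟨by linarith, by linarith [hP2 i]⟩
      have hQ2 := (hA0 Q hQA).2
      obtain ⟨j, -, hj⟩ := Finset.exists_min_image Finset.univ (fun j => toLex (u j Q, j))
        ⟨i, Finset.mem_univ _⟩
      replace hj : ∀ l, u j Q < u l Q ∨ u j Q = u l Q ∧ j ≤ l := fun l => by
        simpa [Prod.Lex.toLex_le_toLex] using hj l (Finset.mem_univ _)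
      have hji : u j Q ≤ u i Q := by
        rcases hj i with h | h
        · exact h.le
        · exact h.1.le
      have hi1 : u i Q ≤ 1 := (div_le_one (reach_pos _ hk hQ2)).2 hQr
      refine Set.mem_iUnion.2 ⟨j, Q, ⟨hQA, hji.trans hi1, hj⟩, ?_⟩
      rw [pull_eq_pull_of_ratio_le (he i) (he j) hk hQ2 (hc0 j) hQr hji ?_, hQP]
      rw [hQP, hce, hQn, sub_sub_cancel]
      exact hi j
    · left
      push Not at hnear
      have hPA : P ∈ A := by
        refine ⟨?_, hP1⟩
        rcases hP3 with h | ⟨i, hi⟩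
        · exact h
        · linarith [hnear i]
      refine ⟨hPA, fun hPY => ?_⟩
      obtain ⟨i, hi⟩ := Set.mem_iUnion.1 hPY
      have hP2' := (hA0 P hPA).2
      have hb := reach_pos (e i) hk hP2'
      have hle : ‖c i‖ ≤ reach k (e i) P := (div_le_one hb).1 hi.2.1
      have hinner : inner ℝ (e i) P ≤ ‖c i‖ :=
        (real_inner_le_norm _ _).trans (by rw [he, one_mul]; exact hP1.trans (hc i))
      have hdist := norm_sub_smul_le_of_le_reach (he i) hk hP2' hinner hle
      rw [hce] at hdist
      linarith [hnear i]
  calc _ ≤ volume ((A \ ⋃ i, Y i) ∪ ⋃ i, pull k ‖c i‖ (e i) '' Y i) := measure_mono hcover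
    _ ≤ volume (A \ ⋃ i, Y i) + volume (⋃ i, pull k ‖c i‖ (e i) '' Y i) :=
        measure_union_le _ _
    _ ≤ volume (A \ ⋃ i, Y i) + ∑ i, volume (Y i) := by
        gcongr
        refine (measure_iUnion_fintype_le _ _).trans (Finset.sum_le_sum fun i _ => ?_)
        exact volume_image_pull_le _ (he i) hk (hYm i) fun Q hQ => hA0 Q (hYA i hQ)
    _ = volume (A \ ⋃ i, Y i) + volume (⋃ i, Y i) := by
        rw [measure_iUnion hYd hYm, tsum_fintype]
    _ = volume A := by
        rw [add_comm]
        exact measure_add_sdiff (MeasurableSet.iUnion hYm).nullMeasurableSet A |>.trans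
          (by rw [Set.union_eq_self_of_subset_left (Set.iUnion_subset hYA)])

lemma volume_annulus_fin_two {R ε : ℝ} (hε : 0 ≤ ε) (hεR : ε ≤ R) :
    volume {Q : EuclideanSpace ℝ (Fin 2) | R - ε ≤ ‖Q‖ ∧ ‖Q‖ ≤ R + ε} =
      ENNReal.ofReal (4 * Real.pi * ε * R) := by
  have : {Q : EuclideanSpace ℝ (Fin 2) | R - ε ≤ ‖Q‖ ∧ ‖Q‖ ≤ R + ε} =
      Metric.closedBall 0 (R + ε) \ Metric.ball 0 (R - ε) := by
    ext Q
    simp [and_comm]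
  rw [this, measure_sdiff (Metric.ball_subset_closedBall.trans
      (Metric.closedBall_subset_closedBall (by linarith)))
    measurableSet_ball.nullMeasurableSet measure_ball_lt_top.ne,
    EuclideanSpace.volume_closedBall_fin_two, EuclideanSpace.volume_ball_fin_two,
    ← ENNReal.ofReal_pow (by linarith), ← ENNReal.ofReal_pow (by linarith),
    ← ENNReal.ofReal_mul (by positivity), ← ENNReal.ofReal_mul (by positivity),
    ← ENNReal.ofReal_sub _ (by positivity)]
  congr 1
  ring

/-- A point of the frontier of a connected component of a closed ball minus finitely many closed
balls lies on one of the spheres and not inside of any removed ball. -/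
lemma mem_spheres_of_mem_frontier_connectedComponentIn {E : Type*} [NormedAddCommGroup E]
    [NormedSpace ℝ E] {ι : Type*} [Finite ι] {O : ι → E} {o x P : E} {R r : ℝ}
    (hP : P ∈ frontier (connectedComponentIn
      (Metric.closedBall o R \ ⋃ i, Metric.closedBall (O i) r) x)) :
    dist P o ≤ R ∧ (∀ i, r ≤ dist P (O i)) ∧ (dist P o = R ∨ ∃ i, dist P (O i) = r) := by
  set F : Set E := Metric.closedBall o R \ ⋃ i, Metric.closedBall (O i) r with hF
  have hsub : connectedComponentIn F x ⊆ {P | dist P o ≤ R} ∩ ⋂ i, {P | r ≤ dist P (O i)} := by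
    intro y hy
    have hyF := connectedComponentIn_subset F x hy
    refine ⟨hyF.1, Set.mem_iInter.2 fun i => ?_⟩
    have : y ∉ Metric.closedBall (O i) r := fun h => hyF.2 (Set.mem_iUnion.2 ⟨i, h⟩)
    exact (not_le.1 (Metric.mem_closedBall.not.1 this)).le
  have hclosed : IsClosed ({P | dist P o ≤ R} ∩ ⋂ i, {P | r ≤ dist P (O i)}) :=
    (isClosed_le (by fun_prop) continuous_const).inter
      (isClosed_iInter fun i => isClosed_le continuous_const (by fun_prop))
  obtain ⟨h1, h2⟩ := closure_minimal hsub hclosed hP.1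
  rw [Set.mem_iInter] at h2
  refine ⟨h1, h2, ?_⟩
  by_contra! hne
  set G : Set E := Metric.ball o R \ ⋃ i, Metric.closedBall (O i) r with hG
  have hGo : IsOpen G :=
    Metric.isOpen_ball.sdiff (isClosed_iUnion_of_finite fun i => Metric.isClosed_closedBall)
  have hPG : P ∈ G := by
    refine ⟨lt_of_le_of_ne h1 hne.1, fun h => ?_⟩
    obtain ⟨i, hi⟩ := Set.mem_iUnion.1 h
    exact hne.2 i (le_antisymm hi (h2 i))
  obtain ⟨δ, hδ, hball⟩ := Metric.isOpen_iff.1 hGo P hPG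
  have hballF : Metric.ball P δ ⊆ F :=
    hball.trans (Set.sdiff_subset_sdiff_left Metric.ball_subset_closedBall)
  obtain ⟨y, hyP, hy⟩ := mem_closure_iff.1 hP.1 _ Metric.isOpen_ball (Metric.mem_ball_self hδ)
  refine hP.2 (mem_interior.2 ⟨_, ?_, Metric.isOpen_ball, Metric.mem_ball_self hδ⟩)
  rw [connectedComponentIn_eq hy]
  exact (convex_ball P δ).isPreconnected.subset_connectedComponentIn hyP hballF

theorem stmt16 {ι : Type} [Fintype ι] (r ε : ℝ) (hε : 0 < ε) (hεr : 2 * ε < r / 3)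
    (O : ι → EuclideanSpace ℝ (Fin 2)) (Oc : EuclideanSpace ℝ (Fin 2))
    (circ : Option ι → Set (EuclideanSpace ℝ (Fin 2)))
    (hcirc : circ = fun a =>
      a.elim (Metric.sphere Oc (r / 3)) fun i => Metric.sphere (O i) r)
    (hgp₂ : ∀ a b : Option ι, a ≠ b →
      circ a ∩ circ b = ∅ ∨ ∃ x y, x ≠ y ∧ circ a ∩ circ b = {x, y})
    (hgp₃ : ∀ a b c : Option ι, a ≠ b → b ≠ c → a ≠ c →
      circ a ∩ circ b ∩ circ c = ∅)
    (ℛ₂ : Set (EuclideanSpace ℝ (Fin 2)))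
    (hℛ₂ : ℛ₂ = Metric.closedBall Oc (r / 3) \ ⋃ i, Metric.closedBall (O i) r) :
    volume (⋃ x ∈ {x : EuclideanSpace ℝ (Fin 2) | x ∈ ℛ₂ ∧
        ENNReal.ofReal (6 * Real.pi * ε) <
          μH[1] (frontier (connectedComponentIn ℛ₂ x))},
      Metric.cthickening ε (frontier (connectedComponentIn ℛ₂ x))) ≤
      ENNReal.ofReal (4 * Real.pi * ε * r / 3) := by
  subst hℛ₂
  by_cases hfar : ∀ i, r / 3 + ε ≤ ‖O i - Oc‖
  · have hkey := volume_near_spheres_le (R := r / 3) (r := r) (ε := ε) (fun i => O i - Oc) hε.le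
      (by linarith) (by linarith) hfar
    rw [volume_annulus_fin_two hε.le (by linarith), ← mul_div_assoc] at hkey
    rw [← (measurePreserving_sub_right volume Oc).measure_preimage_emb
      (measurableEmbedding_subRight Oc)] at hkey
    refine (measure_mono ?_).trans hkey
    refine Set.iUnion₂_subset fun x _ Q hQ => ?_
    rw [isClosed_frontier.cthickening_eq_biUnion_closedBall hε.le] at hQ
    obtain ⟨P, hP, hQP⟩ := Set.mem_iUnion₂.1 hQ
    obtain ⟨hP1, hP2, hP3⟩ := mem_spheres_of_mem_frontier_connectedComponentIn hP
    rw [Metric.mem_closedBall] at hQP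
    have hPQ : dist P Q ≤ ε := dist_comm P Q ▸ hQP
    simp only [Set.mem_preimage, Set.mem_ofPred_eq, ← dist_eq_norm, dist_sub_right]
    refine ⟨by linarith [dist_triangle Q P Oc], fun i => ?_, hP3.imp (fun h => ?_) ?_⟩
    · linarith [dist_triangle P Q (O i), hP2 i]
    · linarith [dist_triangle P Q Oc]
    · rintro ⟨i, hi⟩
      exact ⟨i, by linarith [dist_triangle Q P (O i)]⟩
  · push Not at hfar
    obtain ⟨i, hi⟩ := hfar
    have hempty : Metric.closedBall Oc (r / 3) \ ⋃ i, Metric.closedBall (O i) r = ∅ := by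
      refine Set.sdiff_eq_empty.2 (Set.Subset.trans ?_ (Set.subset_iUnion _ i))
      refine Metric.closedBall_subset_closedBall' ?_
      rw [dist_comm, dist_eq_norm]
      linarith
    rw [hempty]
    simp
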